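/- Let t > 1 be a real number, let n ≥ 1 and 1 ≤ n1 ≤ n be integers, and let N' be a natural number with 2N' ≤ n1. Define α := [M_{n1,n1−2N'}(t) · M_{2n−n1,n1−2N'}(t) / M_{2n,0}(t)] · t^{2N'² + 2(n−n1)N'}. Then 1/C(t) < α < C(t)². (This is the even-N case of the Schmidt coefficient estimate p_{n1,n1−2N'}(1,t) = α · t^{−2N'² − 2(n−n1)N'}.) -/

import Mathlib

noncomputable section

open Finset

/-- Height of the path `w` (of length `L`, up = `true`, down = `false`) after `i` steps. -/
def height {L : ℕ} (w : Fin L → Bool) (i : ℕ) : ℤ :=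
  ∑ j ∈ Finset.univ.filter (fun j : Fin L => (j : ℕ) < i),
    (if w j then (1 : ℤ) else -1)

/-- `DyckSet a b`: the set `D_{a,b}` of paths of length `2a+b` with `a+b` up steps whose
heights stay nonnegative. -/
def DyckSet (a b : ℕ) : Finset (Fin (2 * a + b) → Bool) :=
  Finset.univ.filter (fun w =>
    (Finset.univ.filter (fun j => w j = true)).card = a + b ∧
      ∀ i ≤ 2 * a + b, 0 ≤ height w i)

/-- The area `A(w)` between the path `w` and the x-axis. -/
def area {L : ℕ} (w : Fin L → Bool) : ℝ :=
  (∑ i ∈ Finset.range L, ((height w i + height w (i + 1) : ℤ) : ℝ)) / 2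

/-- The weighted path sum `M_{2a+b,b}(t) = Σ_{w ∈ D_{a,b}} t^{A(w)}`. -/
def M (a b : ℕ) (t : ℝ) : ℝ := ∑ w ∈ DyckSet a b, t ^ area w

/-- `M_{ℓ,m}(t)` for `ℓ ≥ m` with `ℓ - m` even. -/
def Mlm (ℓ m : ℕ) (t : ℝ) : ℝ := M ((ℓ - m) / 2) m t

/-- `P k`: the number of partitions of `k`. -/
def P (k : ℕ) : ℕ := Fintype.card (Nat.Partition k)

/-- `C(t) = Σ_{k=0}^∞ P(k) t^{-2k}`. -/
def C (t : ℝ) : ℝ := ∑' k : ℕ, (P k : ℝ) * t ^ (-(2 : ℝ) * k)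

theorem sum_card_partition_mul_pow_le {q : ℝ} (hq0 : 0 ≤ q) (hq1 : q < 1) (K : ℕ) :
    ∑ k ∈ range K, (P k : ℝ) * q ^ k ≤ Real.exp (q / (1 - q) / (1 - q)) := by
  classical
  let e : (Σ k, Nat.Partition k) → (Fin K → ℕ) := fun x i => x.2.parts.count ((i : ℕ) + 1)
  let S : Finset (Σ k, Nat.Partition k) := (range K).sigma fun _ => univ
  have hsum : ∀ x ∈ S, x.1 = ∑ i : Fin K, e x i * ((i : ℕ) + 1) := by
    rintro ⟨k, p⟩ hx
    have hk : k < K := by simpa [S] using hx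
    have hsub : p.parts.toFinset ⊆ (range K).image (· + 1) := by
      intro j hj
      have hj' := Multiset.mem_toFinset.1 hj
      have h1 := p.parts_pos hj'
      have h2 := p.le_of_mem_parts hj'
      simp only [mem_image, mem_range]
      exact ⟨j - 1, by omega, by omega⟩
    have h := Finset.sum_multiset_count_of_subset p.parts _ hsub
    rw [p.parts_sum, Finset.sum_image (by intro a _ b _ h; simpa using h),
      Finset.sum_range] at h
    simpa [e] using h
  have hinj : Set.InjOn e S := by
    rintro ⟨k, p⟩ hx ⟨l, r⟩ hy hxy
    have hkl : k = l := by
      have h1 := hsum _ hx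
      have h2 := hsum _ hy
      rw [hxy] at h1
      exact h1.trans h2.symm
    subst hkl
    have hk : k < K := by simpa [S] using hx
    congr 1
    ext j
    rcases j with _ | j
    · rw [Multiset.count_eq_zero_of_notMem fun h => (p.parts_pos h).ne rfl,
        Multiset.count_eq_zero_of_notMem fun h => (r.parts_pos h).ne rfl]
    · by_cases hj : j < K
      · exact congrFun hxy ⟨j, hj⟩
      · rw [Multiset.count_eq_zero_of_notMem fun h => by have := p.le_of_mem_parts h; omega,
          Multiset.count_eq_zero_of_notMem fun h => by have := r.le_of_mem_parts h; omega]
  have hmaps : S.image e ⊆ Fintype.piFinset fun _ : Fin K => range K := by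
    intro f hf
    obtain ⟨x, hx, rfl⟩ := mem_image.1 hf
    rw [Fintype.mem_piFinset]
    intro i
    have hk : x.1 < K := by simpa [S] using hx
    have h := Finset.single_le_sum (f := fun i : Fin K => e x i * ((i : ℕ) + 1))
      (fun _ _ => Nat.zero_le _) (mem_univ i)
    rw [← hsum x hx] at h
    simp only [mem_range]
    nlinarith
  have hpos : 0 < 1 - q := by linarith
  calc ∑ k ∈ range K, (P k : ℝ) * q ^ k
      = ∑ x ∈ S, q ^ x.1 := by
        rw [Finset.sum_sigma]
        simp [P]
    _ = ∑ x ∈ S, ∏ i : Fin K, (q ^ ((i : ℕ) + 1)) ^ e x i := by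
        refine Finset.sum_congr rfl fun x hx => ?_
        conv_lhs => rw [hsum x hx, ← Finset.prod_pow_eq_pow_sum]
        refine Finset.prod_congr rfl fun i _ => ?_
        rw [← pow_mul, mul_comm]
    _ = ∑ f ∈ S.image e, ∏ i : Fin K, (q ^ ((i : ℕ) + 1)) ^ f i :=
        (Finset.sum_image (f := fun f => ∏ i : Fin K, (q ^ ((i : ℕ) + 1)) ^ f i) hinj).symm
    _ ≤ ∑ f ∈ Fintype.piFinset fun _ : Fin K => range K,
          ∏ i : Fin K, (q ^ ((i : ℕ) + 1)) ^ f i :=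
        Finset.sum_le_sum_of_subset_of_nonneg hmaps fun _ _ _ => by positivity
    _ = ∏ i : Fin K, ∑ j ∈ range K, (q ^ ((i : ℕ) + 1)) ^ j :=
        (Finset.prod_univ_sum _ _).symm
    _ ≤ ∏ i : Fin K, Real.exp (q ^ ((i : ℕ) + 1) / (1 - q)) := by
        refine Finset.prod_le_prod (fun _ _ => by positivity) fun i _ => ?_
        have hle : q ^ ((i : ℕ) + 1) ≤ q := pow_le_of_le_one hq0 hq1.le (by omega)
        have h0 : 0 ≤ q ^ ((i : ℕ) + 1) := by positivity
        generalize q ^ ((i : ℕ) + 1) = y at hle h0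
        have hy : 0 < 1 - y := by linarith
        have hgeom : ∑ j ∈ range K, y ^ j ≤ 1 / (1 - y) := by
          rw [le_div_iff₀ hy]
          have := geom_sum_mul_neg y K
          have := pow_nonneg h0 K
          linarith
        have hfrac : 1 / (1 - y) = 1 + y / (1 - y) := by field_simp; ring
        have hmono : y / (1 - y) ≤ y / (1 - q) := by gcongr
        have := Real.add_one_le_exp (y / (1 - q))
        linarith
    _ = Real.exp (∑ i : Fin K, q ^ ((i : ℕ) + 1) / (1 - q)) := (Real.exp_sum _ _).symm
    _ ≤ Real.exp (q / (1 - q) / (1 - q)) := by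
        rw [Real.exp_le_exp, ← Finset.sum_div]
        gcongr
        rw [← Finset.sum_range fun i => q ^ (i + 1), le_div_iff₀ hpos]
        have h := geom_sum_mul_neg q K
        have h' : ∑ i ∈ range K, q ^ (i + 1) = q * ∑ i ∈ range K, q ^ i := by
          rw [Finset.mul_sum]
          exact Finset.sum_congr rfl fun i _ => by ring
        rw [h', mul_assoc, h]
        have : 0 ≤ q * q ^ K := by positivity
        linarith

theorem summable_card_partition_mul_pow {q : ℝ} (hq0 : 0 ≤ q) (hq1 : q < 1) :
    Summable fun k : ℕ => (P k : ℝ) * q ^ k :=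
  summable_of_sum_range_le (fun _ => by positivity) (sum_card_partition_mul_pow_le hq0 hq1)

theorem P_pos (k : ℕ) : 0 < P k := Fintype.card_pos

theorem sum_lt_tsum_card_partition {q : ℝ} (hq0 : 0 < q) (hq1 : q < 1) (K : ℕ) :
    ∑ k ∈ range K, (P k : ℝ) * q ^ k < ∑' k : ℕ, (P k : ℝ) * q ^ k := by
  have hterm : 0 < (P K : ℝ) * q ^ K :=
    mul_pos (Nat.cast_pos.2 (P_pos K)) (pow_pos hq0 K)
  have h := (summable_card_partition_mul_pow hq0.le hq1).sum_le_tsum (range (K + 1))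
    fun _ _ => by positivity
  rw [Finset.sum_range_succ] at h
  linarith

theorem C_eq_tsum_pow {t : ℝ} (ht : 0 < t) :
    C t = ∑' k : ℕ, (P k : ℝ) * (t ^ (-2 : ℝ)) ^ k := by
  simp only [C, Real.rpow_mul_natCast ht.le]

/-- The nonzero entries among the numbers of up steps following each down step of `l`. -/
def upsAfterDowns : List Bool → Multiset ℕ
  | [] => 0
  | true :: l => upsAfterDowns l
  | false :: l => if l.count true = 0 then upsAfterDowns l else l.count true ::ₘ upsAfterDowns l

theorem pos_of_mem_upsAfterDowns {l : List Bool} {i : ℕ} (hi : i ∈ upsAfterDowns l) : 0 < i := by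
  induction l with
  | nil => simp [upsAfterDowns] at hi
  | cons s l ih =>
    cases s
    · simp only [upsAfterDowns] at hi
      split_ifs at hi with h
      · exact ih hi
      · rcases Multiset.mem_cons.1 hi with rfl | hi
        · omega
        · exact ih hi
    · exact ih hi

theorem le_count_of_mem_upsAfterDowns {l : List Bool} {i : ℕ} (hi : i ∈ upsAfterDowns l) :
    i ≤ l.count true := by
  induction l with
  | nil => simp [upsAfterDowns] at hi
  | cons s l ih =>
    cases s
    · simp only [upsAfterDowns] at hi
      rw [List.count_cons_of_ne (by decide)]
      split_ifs at hi with h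
      · exact ih hi
      · rcases Multiset.mem_cons.1 hi with rfl | hi
        · exact le_rfl
        · exact ih hi
    · rw [List.count_cons_self]
      exact (ih hi).trans (Nat.le_succ _)

theorem upsAfterDowns_false_ne_true {l l' : List Bool}
    (hc : (false :: l).count true = (true :: l').count true) :
    upsAfterDowns (false :: l) ≠ upsAfterDowns (true :: l') := by
  rw [List.count_cons_of_ne (by decide), List.count_cons_self] at hc
  intro h
  have hmem : l.count true ∈ upsAfterDowns (false :: l) := by
    simp only [upsAfterDowns]
    rw [if_neg (by omega)]
    exact Multiset.mem_cons_self _ _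
  rw [h] at hmem
  have := le_count_of_mem_upsAfterDowns (l := l') hmem
  omega

theorem eq_of_upsAfterDowns_eq {l l' : List Bool} (hlen : l.length = l'.length)
    (hc : l.count true = l'.count true) (h : upsAfterDowns l = upsAfterDowns l') : l = l' := by
  induction l generalizing l' with
  | nil => exact (List.length_eq_zero_iff.1 hlen.symm).symm
  | cons s l ih =>
    rcases l' with _ | ⟨s', l'⟩
    · simp at hlen
    have hlen' : l.length = l'.length := by simpa using hlen
    cases s <;> cases s'
    · have hc' : l.count true = l'.count true := by simpa using hc
      simp only [upsAfterDowns, hc'] at h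
      rw [ih hlen' hc']
      split_ifs at h with h0
      · exact h
      · exact (Multiset.cons_inj_right _).1 h
    · exact absurd h (upsAfterDowns_false_ne_true hc)
    · exact absurd h.symm (upsAfterDowns_false_ne_true hc.symm)
    · rw [ih hlen' (by simpa using hc) h]

theorem height_cons_succ {L : ℕ} (s : Bool) (w : Fin L → Bool) (i : ℕ) :
    height (Fin.cons s w : Fin (L + 1) → Bool) (i + 1) = (if s then 1 else -1) + height w i := by
  simp [height, Finset.sum_filter, Fin.sum_univ_succ]

theorem height_zero {L : ℕ} (w : Fin L → Bool) : height w 0 = 0 := by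
  simp [height]

theorem area_cons {L : ℕ} (s : Bool) (w : Fin L → Bool) :
    area (Fin.cons s w : Fin (L + 1) → Bool) =
      (if s then 1 else -1) * (1 / 2 + L) + area w := by
  simp only [area]
  rw [Finset.sum_range_succ']
  simp only [height_cons_succ, height_zero, zero_add]
  have : ∀ i, (((if s then (1 : ℤ) else -1) + height w i
      + ((if s then 1 else -1) + height w (i + 1)) : ℤ) : ℝ)
      = 2 * (if s then 1 else -1) + ((height w i + height w (i + 1) : ℤ) : ℝ) := by
    intro i
    split_ifs <;> push_cast <;> ring
  simp only [this, Finset.sum_add_distrib, Finset.sum_const, card_range, nsmul_eq_mul]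
  split_ifs <;> push_cast <;> ring

theorem area_add_two_mul_sum {L : ℕ} (w : Fin L → Bool) :
    area w + 2 * ((upsAfterDowns (List.ofFn w)).sum : ℝ) =
      ((List.ofFn w).count true : ℝ) ^ 2 / 2
        + (List.ofFn w).count true * (List.ofFn w).count false
        - ((List.ofFn w).count false : ℝ) ^ 2 / 2 := by
  induction L with
  | zero => simp [area, upsAfterDowns]
  | succ L ih =>
    obtain ⟨s, v, rfl⟩ : ∃ s v, w = Fin.cons s v := ⟨w 0, Fin.tail w, (Fin.cons_self_tail w).symm⟩
    have hL : (L : ℝ) = (List.ofFn v).count true + (List.ofFn v).count false := by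
      have := List.count_true_add_count_false (l := List.ofFn v)
      rw [List.length_ofFn] at this
      exact_mod_cast this.symm
    have h := ih v
    rw [area_cons, List.ofFn_cons]
    cases s
    · have hsum : (upsAfterDowns (false :: List.ofFn v)).sum
          = (List.ofFn v).count true + (upsAfterDowns (List.ofFn v)).sum := by
        simp only [upsAfterDowns]
        split_ifs with h0
        · omega
        · exact Multiset.sum_cons _ _
      rw [hsum, List.count_cons_self, List.count_cons_of_ne (by decide), hL]
      simp only [Bool.false_eq_true, if_false, Nat.cast_add, Nat.cast_one]
      linarith
    · rw [List.count_cons_self, List.count_cons_of_ne (by decide), hL]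
      simp only [upsAfterDowns, if_true, Nat.cast_add, Nat.cast_one]
      linarith

theorem count_true_ofFn {L : ℕ} (w : Fin L → Bool) :
    (List.ofFn w).count true = (univ.filter fun j => w j = true).card := by
  induction L with
  | zero => simp
  | succ L ih =>
    rw [List.ofFn_succ, Fin.univ_succ, Finset.filter_cons, List.count_cons, ih]
    split_ifs <;> simp_all [Finset.filter_map]

theorem count_true_of_mem_DyckSet {a b : ℕ} {w : Fin (2 * a + b) → Bool} (hw : w ∈ DyckSet a b) :
    (List.ofFn w).count true = a + b := by
  rw [count_true_ofFn]
  exact (mem_filter.1 hw).2.1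

/-- The largest area of a path in `DyckSet a b`. -/
def maxArea (a b : ℕ) : ℝ := (a : ℝ) ^ 2 + 2 * a * b + (b : ℝ) ^ 2 / 2

theorem area_of_count_true {a b : ℕ} {w : Fin (2 * a + b) → Bool}
    (hc : (List.ofFn w).count true = a + b) :
    area w = maxArea a b - 2 * ((upsAfterDowns (List.ofFn w)).sum : ℝ) := by
  have h := area_add_two_mul_sum w
  have h2 := List.count_true_add_count_false (l := List.ofFn w)
  rw [List.length_ofFn, hc] at h2
  have h3 : (List.ofFn w).count false = a := by omega
  rw [hc, h3] at h
  simp only [Nat.cast_add] at h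
  simp only [maxArea]
  linarith

theorem rpow_area {t : ℝ} (ht : 0 < t) {a b : ℕ} {w : Fin (2 * a + b) → Bool}
    (hw : w ∈ DyckSet a b) :
    t ^ area w = t ^ maxArea a b * (t ^ (-2 : ℝ)) ^ (upsAfterDowns (List.ofFn w)).sum := by
  rw [area_of_count_true (count_true_of_mem_DyckSet hw), ← Real.rpow_mul_natCast ht.le,
    ← Real.rpow_add ht]
  ring_nf

theorem card_filter_sum_upsAfterDowns_le (a b k : ℕ) :
    ((DyckSet a b).filter fun w => (upsAfterDowns (List.ofFn w)).sum = k).card ≤ P k := by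
  rw [← Fintype.card_coe]
  refine Fintype.card_le_of_injective
    (fun w => (⟨upsAfterDowns (List.ofFn w.1), fun hi => pos_of_mem_upsAfterDowns hi,
      (mem_filter.1 w.2).2⟩ : Nat.Partition k)) ?_
  intro w w' h
  have h' := congrArg Nat.Partition.parts h
  refine Subtype.ext (List.ofFn_injective (eq_of_upsAfterDowns_eq (by simp) ?_ h'))
  rw [count_true_of_mem_DyckSet (mem_filter.1 w.2).1,
    count_true_of_mem_DyckSet (mem_filter.1 w'.2).1]

theorem M_lt {t : ℝ} (ht : 1 < t) (a b : ℕ) : M a b t < C t * t ^ maxArea a b := by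
  have ht0 : 0 < t := by linarith
  have hq0 : 0 < t ^ (-2 : ℝ) := Real.rpow_pos_of_pos ht0 _
  have hq1 : t ^ (-2 : ℝ) < 1 := Real.rpow_lt_one_of_one_lt_of_neg ht (by norm_num)
  have hm : 0 < t ^ maxArea a b := Real.rpow_pos_of_pos ht0 _
  rw [M, Finset.sum_congr rfl fun w hw => rpow_area ht0 hw, ← Finset.mul_sum, mul_comm]
  refine mul_lt_mul_of_pos_right ?_ hm
  rw [C_eq_tsum_pow ht0]
  generalize t ^ (-2 : ℝ) = q at hq0 hq1
  let K := (DyckSet a b).sup (fun w => (upsAfterDowns (List.ofFn w)).sum) + 1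
  refine lt_of_le_of_lt ?_ (sum_lt_tsum_card_partition hq0 hq1 K)
  rw [← Finset.sum_fiberwise_of_maps_to (t := range K)
    (g := fun w => (upsAfterDowns (List.ofFn w)).sum) fun w hw => mem_range.2
      (Nat.lt_succ_of_le (Finset.le_sup (f := fun w => (upsAfterDowns (List.ofFn w)).sum) hw))]
  refine Finset.sum_le_sum fun k _ => ?_
  rw [Finset.sum_congr rfl fun w hw => by rw [(mem_filter.1 hw).2], Finset.sum_const,
    nsmul_eq_mul]
  gcongr
  exact card_filter_sum_upsAfterDowns_le a b k

theorem count_true_ofFn_decide_lt {L m : ℕ} (hm : m ≤ L) :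
    (List.ofFn fun j : Fin L => decide ((j : ℕ) < m)).count true = m := by
  induction L generalizing m with
  | zero => simp; omega
  | succ L ih =>
    rcases m with _ | m
    · simp [List.count_replicate]
    · simpa [List.ofFn_succ] using ih (m := m) (by omega)

theorem upsAfterDowns_ofFn_decide_lt (L m : ℕ) :
    upsAfterDowns (List.ofFn fun j : Fin L => decide ((j : ℕ) < m)) = 0 := by
  induction L generalizing m with
  | zero => simp [upsAfterDowns]
  | succ L ih =>
    rcases m with _ | m
    · have h := ih 0
      simp only [Nat.not_lt_zero, decide_false, List.ofFn_const] at h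
      simp [upsAfterDowns, h, List.count_replicate]
    · simpa [List.ofFn_succ, upsAfterDowns] using ih m

theorem height_succ {L : ℕ} (w : Fin L → Bool) {i : ℕ} (hi : i < L) :
    height w (i + 1) = height w i + if w ⟨i, hi⟩ then 1 else -1 := by
  have : (univ.filter fun j : Fin L => (j : ℕ) < i + 1)
      = insert ⟨i, hi⟩ (univ.filter fun j : Fin L => (j : ℕ) < i) := by
    ext j
    simp only [mem_filter, mem_univ, true_and, mem_insert, Fin.ext_iff]
    omega
  rw [height, this, Finset.sum_insert (by simp), add_comm]
  rfl

theorem height_decide_lt {L m i : ℕ} (hi : i ≤ L) :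
    height (fun j : Fin L => decide ((j : ℕ) < m)) i = (min i m : ℕ) - ((i - m : ℕ) : ℤ) := by
  induction i with
  | zero => simp [height_zero]
  | succ i ih =>
    rw [height_succ _ (by omega), ih (by omega)]
    by_cases h : i < m <;> simp [h] <;> omega

theorem rpow_maxArea_le_M {t : ℝ} (ht : 0 < t) (a b : ℕ) : t ^ maxArea a b ≤ M a b t := by
  let w : Fin (2 * a + b) → Bool := fun j => decide ((j : ℕ) < a + b)
  have hc : (List.ofFn w).count true = a + b := count_true_ofFn_decide_lt (by omega)
  have hw : w ∈ DyckSet a b := by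
    refine mem_filter.2 ⟨mem_univ _, by rw [← count_true_ofFn, hc], fun i hi => ?_⟩
    rw [height_decide_lt hi]
    omega
  have hp : upsAfterDowns (List.ofFn w) = 0 := upsAfterDowns_ofFn_decide_lt _ _
  have harea : area w = maxArea a b := by
    rw [area_of_count_true hc, hp]
    simp
  rw [← harea]
  exact Finset.single_le_sum (f := fun w => t ^ area w)
    (fun _ _ => Real.rpow_nonneg ht.le _) hw

/-- Theorem 1 (even case): the Schmidt coefficient
`p_{n1,n1-2N'}(1,t) = α t^{-2N'² - 2(n-n1)N'}` has `1/C(t) < α < C(t)²`. -/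
theorem stmt_8 (t : ℝ) (ht : 1 < t) (n n1 N' : ℕ)
    (hn : 1 ≤ n) (hn1 : 1 ≤ n1) (hn1n : n1 ≤ n) (hN : 2 * N' ≤ n1) :
    let α := Mlm n1 (n1 - 2 * N') t * Mlm (2 * n - n1) (n1 - 2 * N') t / Mlm (2 * n) 0 t
      * t ^ (2 * N' ^ 2 + 2 * (n - n1) * N')
    1 / C t < α ∧ α < C t ^ 2 := by
  intro α
  obtain ⟨b, rfl⟩ : ∃ b, n1 = 2 * N' + b := ⟨n1 - 2 * N', by omega⟩
  obtain ⟨d, rfl⟩ : ∃ d, n = 2 * N' + b + d := ⟨n - (2 * N' + b), by omega⟩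
  have ht0 : 0 < t := by linarith
  have e0 : 2 * N' + b - 2 * N' = b := by omega
  have e1 : (2 * N' + b - b) / 2 = N' := by omega
  have e2 : (2 * (2 * N' + b + d) - (2 * N' + b) - b) / 2 = N' + d := by omega
  have e3 : (2 * (2 * N' + b + d) - 0) / 2 = 2 * N' + b + d := by omega
  have e4 : 2 * N' + b + d - (2 * N' + b) = d := by omega
  have hα : α = M N' b t * M (N' + d) b t / M (2 * N' + b + d) 0 t
      * t ^ (2 * N' ^ 2 + 2 * d * N') := by
    simp only [α, Mlm, e0, e1, e2, e3, e4]
  clear_value α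
  subst hα
  have l1 := rpow_maxArea_le_M ht0 N' b
  have l2 := rpow_maxArea_le_M ht0 (N' + d) b
  have l3 := rpow_maxArea_le_M ht0 (2 * N' + b + d) 0
  have u1 := M_lt ht N' b
  have u2 := M_lt ht (N' + d) b
  have u3 := M_lt ht (2 * N' + b + d) 0
  have key : t ^ maxArea N' b * t ^ maxArea (N' + d) b * t ^ (2 * N' ^ 2 + 2 * d * N')
      = t ^ maxArea (2 * N' + b + d) 0 := by
    rw [← Real.rpow_natCast, ← Real.rpow_add ht0, ← Real.rpow_add ht0]
    congr 1
    simp only [maxArea]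
    push_cast
    ring
  have p1 : 0 < t ^ maxArea N' b := Real.rpow_pos_of_pos ht0 _
  have p2 : 0 < t ^ maxArea (N' + d) b := Real.rpow_pos_of_pos ht0 _
  have p3 : 0 < t ^ maxArea (2 * N' + b + d) 0 := Real.rpow_pos_of_pos ht0 _
  have p4 : 0 < t ^ (2 * N' ^ 2 + 2 * d * N') := pow_pos ht0 _
  have hC : 0 < C t := pos_of_mul_pos_left (p1.trans_le (l1.trans u1.le)) p1.le
  have hM1 := p1.trans_le l1
  have hM3 := p3.trans_le l3
  rw [div_mul_eq_mul_div]
  constructor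
  · rw [div_lt_div_iff₀ hC hM3, one_mul]
    calc M (2 * N' + b + d) 0 t < C t * t ^ maxArea (2 * N' + b + d) 0 := u3
      _ = t ^ maxArea N' b * t ^ maxArea (N' + d) b * t ^ (2 * N' ^ 2 + 2 * d * N') * C t := by
          rw [key, mul_comm]
      _ ≤ _ := by gcongr
  · rw [div_lt_iff₀ hM3]
    calc M N' b t * M (N' + d) b t * t ^ (2 * N' ^ 2 + 2 * d * N')
        < C t * t ^ maxArea N' b * (C t * t ^ maxArea (N' + d) b)
          * t ^ (2 * N' ^ 2 + 2 * d * N') :=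
          mul_lt_mul_of_pos_right (mul_lt_mul'' u1 u2 (p1.le.trans l1) (p2.le.trans l2)) p4
      _ = C t ^ 2 * t ^ maxArea (2 * N' + b + d) 0 := by rw [← key]; ring
      _ ≤ _ := by gcongr
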